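/- Let V be a real vector space with finrank V = 2s + 1, s ≥ 1, let v ∈ V, and let ξ be a bivector (a grade-2 element of the exterior algebra ⋀V). Then the following are equivalent: (1) there exists a subspace W ⊆ V with finrank W ≤ 2s − 1 such that v ∈ W and ξ lies in ⋀²W; (2) ξ^s = 0 in ⋀V. -/

import Mathlib

open ExteriorAlgebra

namespace ExteriorAlgebra

section

variable {K V : Type*} [Field K] [AddCommGroup V] [Module K V]

theorem range_map_subtype_mono {W W' : Submodule K V} (h : W ≤ W') :
    (map W.subtype).range ≤ (map W'.subtype).range := by
  rintro _ ⟨z, rfl⟩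
  refine ⟨map (Submodule.inclusion h) z, ?_⟩
  change (map W'.subtype) (map (Submodule.inclusion h) z) = map W.subtype z
  rw [← AlgHom.comp_apply, map_comp_map]
  rfl

theorem ι_mem_range_map_subtype {W : Submodule K V} {w : V} (hw : w ∈ W) :
    ι K w ∈ (map W.subtype).range :=
  ⟨ι K ⟨w, hw⟩, map_apply_ι _ _⟩

theorem contractLeft_eq_zero_of_mem_range_map_subtype {W : Submodule K V} {d : Module.Dual K V}
    (hd : W ≤ LinearMap.ker d) {y : ExteriorAlgebra K V} (hy : y ∈ (map W.subtype).range) :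
    CliffordAlgebra.contractLeft (Q := (0 : QuadraticForm K V)) d y = 0 := by
  obtain ⟨z, rfl⟩ := hy
  change CliffordAlgebra.contractLeft (Q := (0 : QuadraticForm K V)) d (map W.subtype z) = 0
  induction z using CliffordAlgebra.left_induction with
  | algebraMap r =>
    rw [AlgHom.commutes]
    exact CliffordAlgebra.contractLeft_algebraMap (0 : QuadraticForm K V) (d := d) r
  | add x y hx hy => rw [map_add, map_add, hx, hy, add_zero]
  | ι_mul x m hx =>
    rw [map_mul, map_apply_ι, CliffordAlgebra.contractLeft_ι_mul, hx, mul_zero, sub_zero,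
      show d (W.subtype m) = 0 from hd m.2, zero_smul]

theorem ι_mul_ne_zero_of_notMem {W : Submodule K V} {a : V} (ha : a ∉ W)
    {y : ExteriorAlgebra K V} (hy : y ∈ (map W.subtype).range) (hy0 : y ≠ 0) :
    ι K a * y ≠ 0 := by
  obtain ⟨d, hda, hd⟩ := Submodule.exists_le_ker_of_notMem ha
  intro h
  have h' := congrArg (CliffordAlgebra.contractLeft (Q := (0 : QuadraticForm K V)) d) h
  rw [CliffordAlgebra.contractLeft_ι_mul, contractLeft_eq_zero_of_mem_range_map_subtype hd hy,
    mul_zero, sub_zero, map_zero] at h'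
  exact (smul_ne_zero hda hy0) h'

theorem ι_mul_ι_swap (a b : V) : ι K a * ι K b = -(ι K b * ι K a) :=
  eq_neg_of_add_eq_zero_left (ι_add_mul_swap a b)

theorem ι_mul_ι_commute (a b : V) (y : ExteriorAlgebra K V) : Commute (ι K a * ι K b) y := by
  induction y using CliffordAlgebra.induction with
  | algebraMap r => exact (Algebra.commutes r _).symm
  | ι c =>
    change ι K a * ι K b * ι K c = ι K c * (ι K a * ι K b)
    rw [mul_assoc, ι_mul_ι_swap b c, mul_neg, ← mul_assoc, ι_mul_ι_swap a c, neg_mul, neg_neg,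
      mul_assoc]
  | mul x y hx hy => exact hx.mul_right hy
  | add x y hx hy => exact hx.add_right hy

theorem ι_mul_ι_mul_self (a b : V) : (ι K a * ι K b) * (ι K a * ι K b) = 0 := by
  rw [← mul_assoc, (ι_mul_ι_commute a b (ι K a)).eq, ← mul_assoc, ι_sq_zero, zero_mul, zero_mul]

theorem ι_mul_ι_add_pow (a b : V) (y : ExteriorAlgebra K V) (n : ℕ) :
    (ι K a * ι K b + y) ^ (n + 1) = y ^ (n + 1) + (n + 1) • (ι K a * (ι K b * y ^ n)) := by
  have hx := ι_mul_ι_mul_self (K := K) a b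
  have hc := ι_mul_ι_commute (K := K) a b
  simp only [← mul_assoc]
  generalize ι K a * ι K b = x at *
  induction n with
  | zero => simp [add_comm]
  | succ n ih =>
    rw [pow_succ, ih, add_mul, mul_add, mul_add, smul_mul_assoc, smul_mul_assoc, mul_assoc x,
      ← (hc (y ^ n)).eq, ← mul_assoc x x, hx, zero_mul, smul_zero, zero_add,
      mul_assoc x, ← pow_succ, ← pow_succ, ← (hc (y ^ (n + 1))).eq, succ_nsmul _ (n + 1)]
    abel

variable {I : Type*}

theorem sum_ι_mul_ι_mem_range_map_subtype {W : Submodule K V} (t : Finset I) {a b : I → V}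
    (ha : ∀ i ∈ t, a i ∈ W) (hb : ∀ i ∈ t, b i ∈ W) :
    ∑ i ∈ t, ι K (a i) * ι K (b i) ∈ (map W.subtype).range :=
  Subalgebra.sum_mem _ fun i hi => Subalgebra.mul_mem _
    (ι_mem_range_map_subtype (ha i hi)) (ι_mem_range_map_subtype (hb i hi))

theorem sum_ι_mul_ι_pow_card_succ (a b : I → V) (t : Finset I) :
    (∑ i ∈ t, ι K (a i) * ι K (b i)) ^ (t.card + 1) = 0 := by
  classical
  induction t using Finset.induction_on with
  | empty => simp
  | insert i t hi ih =>
    rw [Finset.sum_insert hi, Finset.card_insert_of_notMem hi, ι_mul_ι_add_pow, pow_succ, ih]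
    simp

theorem sum_ι_mul_ι_pow_card_ne_zero [CharZero K] {a b : I → V}
    (h : LinearIndependent K (Sum.elim a b)) (t : Finset I) :
    (∑ i ∈ t, ι K (a i) * ι K (b i)) ^ t.card ≠ 0 := by
  classical
  induction t using Finset.induction_on with
  | empty => simp
  | insert i t hi ih =>
    rw [Finset.sum_insert hi, Finset.card_insert_of_notMem hi, ι_mul_ι_add_pow,
      sum_ι_mul_ι_pow_card_succ, zero_add, ← Nat.cast_smul_eq_nsmul K]
    refine smul_ne_zero (Nat.cast_ne_zero.2 t.card.succ_ne_zero) ?_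
    set S : Set (I ⊕ I) := Sum.inl '' (t : Set I) ∪ Sum.inr '' (t : Set I) with hS
    have hSW : Submodule.span K (Sum.elim a b '' S) ≤
        Submodule.span K (Sum.elim a b '' (insert (Sum.inr i) S)) :=
      Submodule.span_mono (Set.image_mono (Set.subset_insert _ _))
    have hmem : (∑ i ∈ t, ι K (a i) * ι K (b i)) ^ t.card ∈
        (map (Submodule.span K (Sum.elim a b '' S)).subtype).range := by
      refine Subalgebra.pow_mem _ (sum_ι_mul_ι_mem_range_map_subtype t ?_ ?_) _
      · exact fun j hj => Submodule.subset_span ⟨Sum.inl j, by simpa [hS] using hj, rfl⟩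
      · exact fun j hj => Submodule.subset_span ⟨Sum.inr j, by simpa [hS] using hj, rfl⟩
    refine ι_mul_ne_zero_of_notMem
      (W := Submodule.span K (Sum.elim a b '' (insert (Sum.inr i) S))) ?_
      (Subalgebra.mul_mem _ (ι_mem_range_map_subtype ?_) (range_map_subtype_mono hSW hmem))
      (ι_mul_ne_zero_of_notMem ?_ hmem ih)
    · exact h.notMem_span_image (x := Sum.inl i) (by simpa [hS] using hi)
    · exact Submodule.subset_span ⟨Sum.inr i, by simp, rfl⟩
    · exact h.notMem_span_image (x := Sum.inr i) (by simpa [hS] using hi)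

theorem exists_sum_ι_mul_ι_eq_add [Fintype I] (a b : I → V) (c : V) {x : V}
    (hx : x ∈ Submodule.span K (insert c (Set.range a ∪ Set.range b))) :
    ∃ a' b' : I → V, ι K x * ι K c + ∑ i, ι K (a i) * ι K (b i) =
      ∑ i, ι K (a' i) * ι K (b' i) := by
  obtain ⟨γ, x, hx', rfl⟩ := Submodule.mem_span_insert.1 hx
  rw [Submodule.span_union, Submodule.mem_sup] at hx'
  obtain ⟨y, hy, z, hz, rfl⟩ := hx'
  obtain ⟨α, rfl⟩ := (Submodule.mem_span_range_iff_exists_fun K).1 hy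
  obtain ⟨β, rfl⟩ := (Submodule.mem_span_range_iff_exists_fun K).1 hz
  refine ⟨fun i => a i - β i • c, fun i => b i + α i • c, ?_⟩
  have hterm : ∀ i, ι K (a i - β i • c) * ι K (b i + α i • c) =
      ι K (a i) * ι K (b i) + (α i • (ι K (a i) * ι K c) + β i • (ι K (b i) * ι K c)) := by
    intro i
    rw [ι_mul_ι_swap (b i) c]
    simp only [map_add, map_smul, map_sub, mul_add, sub_mul, smul_mul_assoc, mul_smul_comm,
      ι_sq_zero, smul_zero, sub_zero, smul_neg]
    abel
  simp only [hterm]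
  simp only [map_add, map_smul, map_sum, add_mul, Finset.sum_mul, smul_mul_assoc,
    ι_sq_zero, smul_zero, zero_add, Finset.sum_add_distrib]
  abel

theorem exists_sum_fin_ι_mul_ι_pred {n : ℕ} {a b : Fin (n + 1) → V}
    (h : ¬ LinearIndependent K (Sum.elim a b)) :
    ∃ a' b' : Fin n → V, ∑ i, ι K (a i) * ι K (b i) = ∑ i, ι K (a' i) * ι K (b' i) := by
  rw [linearIndependent_iff_notMem_span] at h
  push Not at h
  have key : ∀ (i : Fin (n + 1)) (x c : V),
      x ∈ Submodule.span K (insert c (Set.range (a ∘ i.succAbove) ∪ Set.range (b ∘ i.succAbove))) →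
      ι K (a i) * ι K (b i) = ι K x * ι K c →
      ∃ a' b' : Fin n → V, ∑ i, ι K (a i) * ι K (b i) = ∑ i, ι K (a' i) * ι K (b' i) := by
    intro i x c hx hi
    obtain ⟨a', b', hab⟩ := exists_sum_ι_mul_ι_eq_add _ _ c hx
    exact ⟨a', b', by rw [Fin.sum_univ_succAbove _ i, hi, ← hab]; rfl⟩
  obtain ⟨i | i, hi⟩ := h
  · refine key i (a i) (b i) (Submodule.span_mono ?_ hi) rfl
    rintro _ ⟨j | j, hj, rfl⟩
    · obtain ⟨k, rfl⟩ := Fin.exists_succAbove_eq (x := j) (y := i) (by simpa using hj)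
      exact Or.inr (Or.inl ⟨k, rfl⟩)
    · rcases eq_or_ne j i with rfl | hji
      · exact Or.inl rfl
      · obtain ⟨k, rfl⟩ := Fin.exists_succAbove_eq hji
        exact Or.inr (Or.inr ⟨k, rfl⟩)
  · refine key i (b i) (-a i) (Submodule.span_le.2 ?_ hi)
      (by rw [map_neg, mul_neg, ← ι_mul_ι_swap])
    rintro _ ⟨j | j, hj, rfl⟩
    · rcases eq_or_ne j i with rfl | hji
      · exact neg_mem_iff.1 (Submodule.subset_span (Or.inl rfl))
      · obtain ⟨k, rfl⟩ := Fin.exists_succAbove_eq hji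
        exact Submodule.subset_span (Or.inr (Or.inl ⟨k, rfl⟩))
    · obtain ⟨k, rfl⟩ := Fin.exists_succAbove_eq (x := j) (y := i) (by simpa using hj)
      exact Submodule.subset_span (Or.inr (Or.inr ⟨k, rfl⟩))

theorem exists_eq_sum_fin_ι_mul_ι {ξ : ExteriorAlgebra K V} (hξ : ξ ∈ ⋀[K]^2 V) :
    ∃ (n : ℕ) (a b : Fin n → V), ξ = ∑ i, ι K (a i) * ι K (b i) := by
  rw [exteriorPower, pow_two] at hξ
  induction hξ using Submodule.mul_induction_on' with
  | mem_mul_mem x hx y hy =>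
    obtain ⟨u, rfl⟩ := hx
    obtain ⟨w, rfl⟩ := hy
    exact ⟨1, fun _ => u, fun _ => w, by simp⟩
  | add x _ y _ hx hy =>
    obtain ⟨n, a, b, rfl⟩ := hx
    obtain ⟨m, a', b', rfl⟩ := hy
    exact ⟨n + m, Fin.append a a', Fin.append b b', by simp [Fin.sum_univ_add]⟩

/-- Every bivector is a sum of products of disjoint pairs from a linearly independent family. -/
theorem exists_linearIndependent_eq_sum_ι_mul_ι {ξ : ExteriorAlgebra K V} (hξ : ξ ∈ ⋀[K]^2 V) :
    ∃ (n : ℕ) (a b : Fin n → V), LinearIndependent K (Sum.elim a b) ∧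
      ξ = ∑ i, ι K (a i) * ι K (b i) := by
  classical
  have hex := exists_eq_sum_fin_ι_mul_ι hξ
  obtain ⟨a, b, hab⟩ := Nat.find_spec hex
  refine ⟨_, a, b, ?_, hab⟩
  have hmin := fun m => Nat.find_min hex (m := m)
  generalize Nat.find hex = n at *
  cases n with
  | zero => exact linearIndependent_empty_type
  | succ n =>
    by_contra h
    obtain ⟨a', b', h'⟩ := exists_sum_fin_ι_mul_ι_pred h
    exact hmin n n.lt_succ_self ⟨a', b', hab.trans h'⟩

theorem pow_eq_zero_of_mem_span_ι_mul_ι [FiniteDimensional K V] {W : Submodule K V} {s : ℕ}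
    (hW : Module.finrank K W < 2 * s) {ξ : ExteriorAlgebra K V}
    (hξ : ξ ∈ Submodule.span K
      {z : ExteriorAlgebra K V | ∃ w₁ ∈ W, ∃ w₂ ∈ W, z = ι K w₁ * ι K w₂}) :
    ξ ^ s = 0 := by
  have hle : Submodule.span K
      {z : ExteriorAlgebra K V | ∃ w₁ ∈ W, ∃ w₂ ∈ W, z = ι K w₁ * ι K w₂} ≤
      (⋀[K]^2 W).map (map W.subtype).toLinearMap := by
    refine Submodule.span_le.2 ?_
    rintro _ ⟨w₁, h₁, w₂, h₂, rfl⟩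
    refine ⟨ι K ⟨w₁, h₁⟩ * ι K ⟨w₂, h₂⟩, ?_, ?_⟩
    · rw [exteriorPower, pow_two]
      exact Submodule.mul_mem_mul ⟨_, rfl⟩ ⟨_, rfl⟩
    · simp
  obtain ⟨ζ, hζ, rfl⟩ := hle hξ
  have hbot : ⋀[K]^(2 * s) W = ⊥ := by
    rw [← Submodule.finrank_eq_zero (R := K), exteriorPower.finrank_eq, Nat.choose_eq_zero_of_lt hW]
  have hζs : ζ ^ s ∈ ⋀[K]^(2 * s) W := by
    rw [exteriorPower, pow_mul]
    exact Submodule.pow_mem_pow _ hζ s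
  rw [hbot, Submodule.mem_bot] at hζs
  rw [AlgHom.toLinearMap_apply, ← map_pow, hζs, map_zero]

end

end ExteriorAlgebra

/-- Polynomial equation of the abnormal set of the free step-2 Carnot group of odd rank
`2s + 1`: a pair `(v, ξ)` with `ξ` a bivector lies in `W ⊕ ⋀²W` for some subspace `W` of
dimension at most `2s − 1` if and only if `ξ^s = 0` (no condition on `v`). -/
theorem sard_abnormal_odd_rank (V : Type*) [AddCommGroup V] [Module ℝ V]
    [FiniteDimensional ℝ V] (s : ℕ) (hs : 1 ≤ s)
    (hdim : Module.finrank ℝ V = 2 * s + 1)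
    (v : V) (ξ : ExteriorAlgebra ℝ V) (hξ : ξ ∈ ⋀[ℝ]^2 V) :
    (∃ W : Submodule ℝ V, Module.finrank ℝ W ≤ 2 * s - 1 ∧ v ∈ W ∧
        ξ ∈ Submodule.span ℝ
          {z : ExteriorAlgebra ℝ V | ∃ w₁ ∈ W, ∃ w₂ ∈ W, z = ι ℝ w₁ * ι ℝ w₂}) ↔
      ξ ^ s = 0 := by
  constructor
  · rintro ⟨W, hW, -, hξW⟩
    exact pow_eq_zero_of_mem_span_ι_mul_ι (by lia) hξW
  · intro h0
    obtain ⟨n, a, b, hab, rfl⟩ := exists_linearIndependent_eq_sum_ι_mul_ι hξ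
    have hn : n < s := by
      by_contra! hsn
      have hne := sum_ι_mul_ι_pow_card_ne_zero hab Finset.univ
      rw [Finset.card_fin] at hne
      exact hne (pow_eq_zero_of_le hsn h0)
    refine ⟨Submodule.span ℝ (Set.range (Sum.elim a b)) ⊔ Submodule.span ℝ {v}, ?_,
      Submodule.mem_sup_right (Submodule.mem_span_singleton_self v),
      Submodule.sum_mem _ fun i _ => Submodule.subset_span
        ⟨a i, Submodule.mem_sup_left (Submodule.subset_span ⟨Sum.inl i, rfl⟩),
          b i, Submodule.mem_sup_left (Submodule.subset_span ⟨Sum.inr i, rfl⟩), rfl⟩⟩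
    have h₁ := Submodule.finrank_add_le_finrank_add_finrank
      (Submodule.span ℝ (Set.range (Sum.elim a b))) (Submodule.span ℝ {v})
    have h₂ : Module.finrank ℝ (Submodule.span ℝ (Set.range (Sum.elim a b))) ≤ _ :=
      finrank_range_le_card (Sum.elim a b)
    have h₃ := finrank_span_le_card (R := ℝ) ({v} : Set V)
    simp only [Fintype.card_sum, Fintype.card_fin, Set.toFinset_singleton,
      Finset.card_singleton] at h₂ h₃
    lia
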